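/- Let λ: ℝ → (0,∞) satisfy the admissibility condition. If a ∈ BS^m_σ(λ;t), then for all j, k ∈ ℤ the scaled and localized bisymbol a^t_{jk}(q,p,q') := a(r, (λ^t_{jk})^{-1}θ, ρ, λ^t_{jk}η, r', (λ^t_{jk})^{-1}θ') ψ_j(r) ψ_k(r') belongs to BS^m_σ(1;t). Moreover, for each integer M ≥ 0 there exists a constant C_M > 0 such that |a^t_{jk}|_{1:M,m,σ,t} ≤ C_M |a|_{λ:M,m,σ,t} for all t ∈ [0,1], all a ∈ BS^m_σ(λ;t) and all j, k ∈ ℤ. -/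

import Mathlib

open MeasureTheory Real
open scoped BigOperators Classical

noncomputable section

/-- Points of `ℝⁿ`. The coordinate `q 0` plays the role of the radial variable `r`,
the remaining coordinates are the angular variables `θ`. -/
abbrev Vec (n : ℕ) := Fin n → ℝ

/-- Complex-valued partial derivative in the coordinate direction `i`. -/
def pdC {n : ℕ} (i : Fin n) (f : Vec n → ℂ) : Vec n → ℂ :=
  fun x => fderiv ℝ f x (Pi.single i 1)

/-- Iterated (multiindex) partial derivative `∂^A f`. -/
def mpd {n : ℕ} (A : Fin n → ℕ) (f : Vec n → ℂ) : Vec n → ℂ :=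
  (List.finRange n).foldr (fun i g => (pdC i)^[A i] g) f

/-- Real-valued partial derivative in the coordinate direction `i`. -/
def pdR {n : ℕ} (i : Fin n) (f : Vec n → ℝ) : Vec n → ℝ :=
  fun x => fderiv ℝ f x (Pi.single i 1)

/-- Iterated (multiindex) partial derivative, real valued. -/
def mpdR {n : ℕ} (A : Fin n → ℕ) (f : Vec n → ℝ) : Vec n → ℝ :=
  (List.finRange n).foldr (fun i g => (pdR i)^[A i] g) f

/-- Total length `|A| = α₀ + |α|` of a multiindex. -/
def fullLen {n : ℕ} (A : Fin n → ℕ) : ℕ := ∑ i, A i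

/-- Angular length `|α|` of a multiindex `A = (α₀, α)`. -/
def angLen {n : ℕ} [NeZero n] (A : Fin n → ℕ) : ℕ := ∑ i, if i = 0 then 0 else A i

/-- The weighted Japanese bracket `⟨ρ ⊕ μ⁻¹ η⟩ = (1 + ρ² + μ⁻²|η|²)^(1/2)`,
where `ρ = p 0` and `η` are the remaining coordinates of `p`. -/
def jbr {n : ℕ} [NeZero n] (μ : ℝ) (p : Vec n) : ℝ :=
  Real.sqrt (1 + ∑ i, (if i = 0 then p i else μ⁻¹ * p i) ^ 2)

/-- Derivative `∂_q^A` of a function `a(q, p)` in the first slot. -/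
def dqS {n : ℕ} (A : Fin n → ℕ) (a : Vec n → Vec n → ℂ) : Vec n → Vec n → ℂ :=
  fun q p => mpd A (fun x => a x p) q

/-- Derivative `∂_p^B` of a function `a(q, p)` in the second slot. -/
def dpS {n : ℕ} (B : Fin n → ℕ) (a : Vec n → Vec n → ℂ) : Vec n → Vec n → ℂ :=
  fun q p => mpd B (fun x => a q x) p

/-- Derivative `∂_q^A` of a function `a(q, p, q')` in the first slot. -/
def d1B {n : ℕ} (A : Fin n → ℕ) (a : Vec n → Vec n → Vec n → ℂ) :
    Vec n → Vec n → Vec n → ℂ :=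
  fun q p q' => mpd A (fun x => a x p q') q

/-- Derivative `∂_p^B` of a function `a(q, p, q')` in the second slot. -/
def d2B {n : ℕ} (B : Fin n → ℕ) (a : Vec n → Vec n → Vec n → ℂ) :
    Vec n → Vec n → Vec n → ℂ :=
  fun q p q' => mpd B (fun x => a q x q') p

/-- Derivative `∂_{q'}^{A'}` of a function `a(q, p, q')` in the third slot. -/
def d3B {n : ℕ} (A' : Fin n → ℕ) (a : Vec n → Vec n → Vec n → ℂ) :
    Vec n → Vec n → Vec n → ℂ :=
  fun q p q' => mpd A' (fun x => a q p x) q'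

/-- The admissibility condition for the weight `λ : ℝ → (0,∞)`:
`λ` is positive and `C₀⁻¹ ≤ λ(r)/λ(r') ≤ C₀` whenever `|r - r'| ≤ 1`. -/
def Admissible (lam : ℝ → ℝ) : Prop :=
  (∀ r, 0 < lam r) ∧
  ∃ C > 0, ∀ r r' : ℝ, |r - r'| ≤ 1 → C⁻¹ ≤ lam r / lam r' ∧ lam r / lam r' ≤ C

/-- The symbol class `S^m_σ(λ)`:  `a` is smooth on `ℝ^{2n}` and for all multiindices
`A = (α₀, α)`, `B = (β₀, β)`,
`|(λ(r)⁻¹∂_θ)^α (λ(r)∂_η)^β ∂_r^{α₀} ∂_ρ^{β₀} a(q,p)| ≤ C ⟨ρ ⊕ λ(r)⁻¹η⟩^{m - σ|B|}`.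
(The weights `λ(r)^{±1}` commute with the `θ`- and `η`-derivatives, so the weighted
derivative equals `λ(r)^{|β| - |α|}` times the plain mixed partial derivative.) -/
def IsSymbol {n : ℕ} [NeZero n] (lam : ℝ → ℝ) (m σ : ℝ) (a : Vec n → Vec n → ℂ) : Prop :=
  ContDiff ℝ (⊤ : ℕ∞) (fun x : Vec n × Vec n => a x.1 x.2) ∧
  ∀ A B : Fin n → ℕ, ∃ C > 0, ∀ q p : Vec n,
    lam (q 0) ^ ((angLen B : ℤ) - (angLen A : ℤ)) * ‖dqS A (dpS B a) q p‖
      ≤ C * jbr (lam (q 0)) p ^ (m - σ * (fullLen B : ℝ))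

/-- The seminorm `|a|_{λ : M, m, σ}` on the symbol class `S^m_σ(λ)`. -/
def symSeminorm {n : ℕ} [NeZero n] (lam : ℝ → ℝ) (M : ℕ) (m σ : ℝ)
    (a : Vec n → Vec n → ℂ) : ℝ :=
  ∑ A : Fin n → Fin (M + 1), ∑ B : Fin n → Fin (M + 1),
    if fullLen (fun i => (A i : ℕ)) + fullLen (fun i => (B i : ℕ)) ≤ M then
      ⨆ q : Vec n, ⨆ p : Vec n,
        jbr (lam (q 0)) p ^ (-m + σ * (fullLen (fun i => (B i : ℕ)) : ℝ)) *
          (lam (q 0) ^ ((angLen (fun i => (B i : ℕ)) : ℤ) - (angLen (fun i => (A i : ℕ)) : ℤ)) *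
            ‖dqS (fun i => (A i : ℕ)) (dpS (fun i => (B i : ℕ)) a) q p‖)
    else 0

/-- `λ^t_{jk} := λ(tj + (1-t)k)`. -/
def lamT (lam : ℝ → ℝ) (t : ℝ) (j k : ℤ) : ℝ := lam (t * j + (1 - t) * k)

/-- The bisymbol class `BS^m_σ(λ; t)`. -/
def IsBisymbol {n : ℕ} [NeZero n] (lam : ℝ → ℝ) (m σ t : ℝ)
    (a : Vec n → Vec n → Vec n → ℂ) : Prop :=
  ContDiff ℝ (⊤ : ℕ∞) (fun x : Vec n × Vec n × Vec n => a x.1 x.2.1 x.2.2) ∧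
  ∀ A B A' : Fin n → ℕ, ∃ C > 0, ∀ (j k : ℤ) (q p q' : Vec n),
    |q 0 - (j : ℝ)| ≤ 1 → |q' 0 - (k : ℝ)| ≤ 1 →
    lamT lam t j k ^ ((angLen B : ℤ) - (angLen A : ℤ) - (angLen A' : ℤ)) *
        ‖d1B A (d2B B (d3B A' a)) q p q'‖
      ≤ C * jbr (lamT lam t j k) p ^ (m - σ * (fullLen B : ℝ))

/-- The seminorm `|a|_{λ : M, m, σ, t}` on `BS^m_σ(λ; t)`. -/
def bisymSeminorm {n : ℕ} [NeZero n] (lam : ℝ → ℝ) (M : ℕ) (m σ t : ℝ)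
    (a : Vec n → Vec n → Vec n → ℂ) : ℝ :=
  ∑ A : Fin n → Fin (M + 1), ∑ B : Fin n → Fin (M + 1), ∑ A' : Fin n → Fin (M + 1),
    if fullLen (fun i => (A i : ℕ)) + fullLen (fun i => (B i : ℕ))
        + fullLen (fun i => (A' i : ℕ)) ≤ M then
      ⨆ j : ℤ, ⨆ k : ℤ, ⨆ q : Vec n, ⨆ p : Vec n, ⨆ q' : Vec n,
        if |q 0 - (j : ℝ)| ≤ 1 ∧ |q' 0 - (k : ℝ)| ≤ 1 then
          jbr (lamT lam t j k) p ^ (-m + σ * (fullLen (fun i => (B i : ℕ)) : ℝ)) *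
            (lamT lam t j k ^ ((angLen (fun i => (B i : ℕ)) : ℤ)
                - (angLen (fun i => (A i : ℕ)) : ℤ) - (angLen (fun i => (A' i : ℕ)) : ℤ)) *
              ‖d1B (fun i => (A i : ℕ)) (d2B (fun i => (B i : ℕ))
                  (d3B (fun i => (A' i : ℕ)) a)) q p q'‖)
        else 0
    else 0

/-- The plain bisymbol class `BS^m_σ(1)` (the case `λ ≡ 1`). -/
def IsBisymbolOne {n : ℕ} [NeZero n] (m σ : ℝ) (a : Vec n → Vec n → Vec n → ℂ) : Prop :=
  ContDiff ℝ (⊤ : ℕ∞) (fun x : Vec n × Vec n × Vec n => a x.1 x.2.1 x.2.2) ∧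
  ∀ A B A' : Fin n → ℕ, ∃ C > 0, ∀ q p q' : Vec n,
    ‖d1B A (d2B B (d3B A' a)) q p q'‖ ≤ C * jbr 1 p ^ (m - σ * (fullLen B : ℝ))

/-- The seminorm `|a|_{M, m, σ}` on `BS^m_σ(1)`. -/
def bisymSeminormOne {n : ℕ} [NeZero n] (M : ℕ) (m σ : ℝ)
    (a : Vec n → Vec n → Vec n → ℂ) : ℝ :=
  ∑ A : Fin n → Fin (M + 1), ∑ B : Fin n → Fin (M + 1), ∑ A' : Fin n → Fin (M + 1),
    if fullLen (fun i => (A i : ℕ)) + fullLen (fun i => (B i : ℕ))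
        + fullLen (fun i => (A' i : ℕ)) ≤ M then
      ⨆ q : Vec n, ⨆ p : Vec n, ⨆ q' : Vec n,
        jbr 1 p ^ (-m + σ * (fullLen (fun i => (B i : ℕ)) : ℝ)) *
          ‖d1B (fun i => (A i : ℕ)) (d2B (fun i => (B i : ℕ))
              (d3B (fun i => (A' i : ℕ)) a)) q p q'‖
    else 0

/-- The oscillatory phase `e^{i p · (q - q')}`. -/
def phase {n : ℕ} (p q q' : Vec n) : ℂ :=
  Complex.exp (Complex.I * ((∑ i, p i * (q i - q' i) : ℝ) : ℂ))

/-- The pseudodifferential operator `Op^g(a)` with bisymbol `a`, as an iterated integral: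
`Op^g(a)u(q) = (2π)^{-n} g(q)^{-1/4} ∫ dp ∫ dq' a(q,p,q') e^{ip⋅(q-q')} u(q') g(q')^{1/4}`. -/
def OpG {n : ℕ} (g : Vec n → ℝ) (a : Vec n → Vec n → Vec n → ℂ) (u : Vec n → ℂ) :
    Vec n → ℂ :=
  fun q => (((2 * Real.pi) ^ (-(n : ℤ)) : ℝ) : ℂ) * ((g q ^ (-(1 : ℝ) / 4) : ℝ) : ℂ) *
    ∫ p : Vec n, ∫ q' : Vec n,
      a q p q' * phase p q q' * u q' * ((g q' ^ ((1 : ℝ) / 4) : ℝ) : ℂ)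

/-- The pseudodifferential operator `Op(a) = Op^1(a)` with bisymbol `a`. -/
def Op {n : ℕ} (a : Vec n → Vec n → Vec n → ℂ) (u : Vec n → ℂ) : Vec n → ℂ :=
  fun q => (((2 * Real.pi) ^ (-(n : ℤ)) : ℝ) : ℂ) *
    ∫ p : Vec n, ∫ q' : Vec n, a q p q' * phase p q q' * u q'

/-- The `t`-quantization `Op^{g,t}(a)` of a symbol `a`. -/
def OpSt {n : ℕ} (g : Vec n → ℝ) (t : ℝ) (a : Vec n → Vec n → ℂ) (u : Vec n → ℂ) :
    Vec n → ℂ :=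
  OpG g (fun q p q' => a (t • q + (1 - t) • q') p) u

/-- The quantization `Op(b)` of a symbol `b` (the case `t = 1`, `g ≡ 1`). -/
def OpSym {n : ℕ} (b : Vec n → Vec n → ℂ) (u : Vec n → ℂ) : Vec n → ℂ :=
  Op (fun q p _ => b q p) u

/-- The `L²(g^{1/2}dq)` norm. -/
def L2g {n : ℕ} (g : Vec n → ℝ) (f : Vec n → ℂ) : ℝ :=
  Real.sqrt (∫ q : Vec n, ‖f q‖ ^ 2 * Real.sqrt (g q))

/-- The `L²(dq)` norm. -/
def L2 {n : ℕ} (f : Vec n → ℂ) : ℝ :=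
  Real.sqrt (∫ q : Vec n, ‖f q‖ ^ 2)

end

noncomputable section

/-- The scaling `(r, θ) ↦ (r, μ⁻¹ θ)` in the spatial variables. -/
def scaleQ {n : ℕ} [NeZero n] (μ : ℝ) (q : Vec n) : Vec n :=
  fun i => if i = 0 then q i else μ⁻¹ * q i

/-- The scaling `(ρ, η) ↦ (ρ, μ η)` in the dual variables. -/
def scaleP {n : ℕ} [NeZero n] (μ : ℝ) (p : Vec n) : Vec n :=
  fun i => if i = 0 then p i else μ * p i

/-- The scaled and localized bisymbol
`a^t_{jk}(q,p,q') := a(r, (λ^t_{jk})⁻¹θ, ρ, λ^t_{jk}η, r', (λ^t_{jk})⁻¹θ') ψ_j(r) ψ_k(r')`. -/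
def scaledBisym {n : ℕ} [NeZero n] (lam : ℝ → ℝ) (ψ : ℝ → ℝ) (t : ℝ) (j k : ℤ)
    (a : Vec n → Vec n → Vec n → ℂ) : Vec n → Vec n → Vec n → ℂ :=
  fun q p q' =>
    a (scaleQ (lamT lam t j k) q) (scaleP (lamT lam t j k) p) (scaleQ (lamT lam t j k) q') *
      (ψ (q 0 - j) : ℂ) * (ψ (q' 0 - k) : ℂ)

end

/-! ### Smoothness of partial derivatives -/

theorem contDiff_pdC_param {n : ℕ} {P : Type*} [NormedAddCommGroup P] [NormedSpace ℝ P]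
    {F : P → Vec n → ℂ} (hF : ContDiff ℝ (⊤ : ℕ∞) (fun z : P × Vec n => F z.1 z.2)) (i : Fin n) :
    ContDiff ℝ (⊤ : ℕ∞) (fun z : P × Vec n => pdC i (F z.1) z.2) := by
  have h : ContDiff ℝ (⊤ : ℕ∞) (fun z : P × Vec n => fderiv ℝ (F z.1) z.2) := by
    refine ContDiff.fderiv (f := fun z : P × Vec n => F z.1) (g := fun z => z.2)
      (m := (⊤ : ℕ∞)) (n := (⊤ : ℕ∞)) ?_ contDiff_snd (by simp)
    exact hF.comp ((contDiff_fst.comp contDiff_fst).prodMk contDiff_snd)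
  exact h.clm_apply contDiff_const

theorem contDiff_mpd_param {n : ℕ} {P : Type*} [NormedAddCommGroup P] [NormedSpace ℝ P]
    {F : P → Vec n → ℂ} (hF : ContDiff ℝ (⊤ : ℕ∞) (fun z : P × Vec n => F z.1 z.2))
    (A : Fin n → ℕ) :
    ContDiff ℝ (⊤ : ℕ∞) (fun z : P × Vec n => mpd A (F z.1) z.2) := by
  unfold mpd
  induction List.finRange n with
  | nil => exact hF
  | cons i L ih =>
    simp only [List.foldr_cons]
    induction A i with
    | zero => exact ih
    | succ k ihk =>
      simp only [Function.iterate_succ_apply']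
      exact contDiff_pdC_param
        (F := fun q => (pdC i)^[k] (L.foldr (fun i g => (pdC i)^[A i] g) (F q))) ihk i

theorem contDiff_pdC {n : ℕ} {f : Vec n → ℂ} (hf : ContDiff ℝ (⊤ : ℕ∞) f) (i : Fin n) :
    ContDiff ℝ (⊤ : ℕ∞) (pdC i f) :=
  (contDiff_pdC_param (P := ℝ) (F := fun _ => f) (hf.comp contDiff_snd) i).comp
    (contDiff_const (c := (0 : ℝ)).prodMk contDiff_id)

theorem contDiff_iterate_pdC {n : ℕ} {f : Vec n → ℂ} (hf : ContDiff ℝ (⊤ : ℕ∞) f) (i : Fin n)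
    (k : ℕ) : ContDiff ℝ (⊤ : ℕ∞) ((pdC i)^[k] f) := by
  induction k with
  | zero => exact hf
  | succ k ih => rw [Function.iterate_succ_apply']; exact contDiff_pdC ih i

theorem contDiff_foldr_pdC {n : ℕ} {f : Vec n → ℂ} (hf : ContDiff ℝ (⊤ : ℕ∞) f)
    (A : Fin n → ℕ) (L : List (Fin n)) :
    ContDiff ℝ (⊤ : ℕ∞) (L.foldr (fun i g => (pdC i)^[A i] g) f) := by
  induction L with
  | nil => exact hf
  | cons i L ih => exact contDiff_iterate_pdC ih i (A i)

theorem contDiff_mpd {n : ℕ} {f : Vec n → ℂ} (hf : ContDiff ℝ (⊤ : ℕ∞) f) (A : Fin n → ℕ) :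
    ContDiff ℝ (⊤ : ℕ∞) (mpd A f) :=
  contDiff_foldr_pdC hf A _

theorem contDiff_top_differentiable {n : ℕ} {f : Vec n → ℂ} (hf : ContDiff ℝ (⊤ : ℕ∞) f) :
    Differentiable ℝ f :=
  hf.differentiable (by simp)

/-! ### Linearity -/

theorem pdC_sum {n : ℕ} {ι : Type*} (s : Finset ι) (c : ι → ℂ) {f : ι → Vec n → ℂ}
    (hf : ∀ l, ContDiff ℝ (⊤ : ℕ∞) (f l)) (i : Fin n) :
    pdC i (fun x => ∑ l ∈ s, c l * f l x) = fun x => ∑ l ∈ s, c l * pdC i (f l) x := by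
  funext x
  have h : HasFDerivAt (fun x => ∑ l ∈ s, c l * f l x) (∑ l ∈ s, c l • fderiv ℝ (f l) x) x :=
    HasFDerivAt.fun_sum fun l _ =>
      ((contDiff_top_differentiable (hf l) x).hasFDerivAt.const_mul (c l))
  simp [pdC, h.fderiv]

theorem mpd_sum {n : ℕ} {ι : Type*} (s : Finset ι) (c : ι → ℂ) {f : ι → Vec n → ℂ}
    (hf : ∀ l, ContDiff ℝ (⊤ : ℕ∞) (f l)) (A : Fin n → ℕ) :
    mpd A (fun x => ∑ l ∈ s, c l * f l x) = fun x => ∑ l ∈ s, c l * mpd A (f l) x := by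
  unfold mpd
  induction List.finRange n with
  | nil => rfl
  | cons i L ih =>
    simp only [List.foldr_cons, ih]
    induction A i with
    | zero => rfl
    | succ k ihk =>
      simp only [Function.iterate_succ_apply', ihk]
      exact pdC_sum s c (fun l => contDiff_iterate_pdC (contDiff_foldr_pdC (hf l) A L) i k) i

theorem mpd_const_mul {n : ℕ} (c : ℂ) {f : Vec n → ℂ} (hf : ContDiff ℝ (⊤ : ℕ∞) f)
    (A : Fin n → ℕ) : mpd A (fun x => c * f x) = fun x => c * mpd A f x := by
  simpa using mpd_sum {()} (fun _ => c) (f := fun _ => f) (fun _ => hf) A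

/-! ### Diagonal scalings -/

theorem contDiff_comp_mul {n : ℕ} {f : Vec n → ℂ} (hf : ContDiff ℝ (⊤ : ℕ∞) f) (d : Vec n) :
    ContDiff ℝ (⊤ : ℕ∞) (fun x => f (d * x)) :=
  hf.comp (contDiff_const.mul contDiff_id)

theorem pdC_comp_mul {n : ℕ} {f : Vec n → ℂ} (hf : ContDiff ℝ (⊤ : ℕ∞) f) (d : Vec n)
    (i : Fin n) :
    pdC i (fun x => f (d * x)) = fun x => (d i : ℂ) * pdC i f (d * x) := by
  funext x
  have h : HasFDerivAt (fun x => f (d * x))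
      ((fderiv ℝ f (d * x)).comp (d • ContinuousLinearMap.id ℝ (Vec n))) x :=
    (contDiff_top_differentiable hf (d * x)).hasFDerivAt.comp x ((hasFDerivAt_id x).const_mul d)
  have hs : d * Pi.single i (1 : ℝ) = d i • (Pi.single i (1 : ℝ) : Vec n) := by
    ext l
    by_cases hl : l = i
    · subst hl; simp
    · simp [hl]
  simp [pdC, h.fderiv, hs]

theorem mpd_comp_mul {n : ℕ} {f : Vec n → ℂ} (hf : ContDiff ℝ (⊤ : ℕ∞) f) (d : Vec n)
    (A : Fin n → ℕ) :
    mpd A (fun x => f (d * x)) = fun x => (∏ i, (d i : ℂ) ^ A i) * mpd A f (d * x) := by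
  unfold mpd
  rw [Fin.prod_univ_def]
  induction List.finRange n with
  | nil => simp
  | cons i L ih =>
    simp only [List.foldr_cons, ih, List.map_cons, List.prod_cons]
    induction A i with
    | zero => simp
    | succ k ihk =>
      have hs := contDiff_iterate_pdC (contDiff_foldr_pdC hf A L) i k
      simp only [Function.iterate_succ_apply', ihk]
      have h := pdC_sum {()} (fun _ => (d i : ℂ) ^ k * (L.map fun i => (d i : ℂ) ^ A i).prod)
        (fun _ => contDiff_comp_mul hs d) i
      simp only [Finset.sum_singleton] at h
      rw [h, pdC_comp_mul hs]
      funext x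
      ring

/-! ### Products with functions of the radial variable -/

theorem contDiff_comp_coord {n : ℕ} {g : ℝ → ℂ} (hg : ContDiff ℝ (⊤ : ℕ∞) g) (l : Fin n) :
    ContDiff ℝ (⊤ : ℕ∞) (fun x : Vec n => g (x l)) :=
  hg.comp (contDiff_apply ℝ ℝ l)

theorem pdC_mul_comp_coord {n : ℕ} {f : Vec n → ℂ} (hf : ContDiff ℝ (⊤ : ℕ∞) f) {g : ℝ → ℂ}
    (hg : ContDiff ℝ (⊤ : ℕ∞) g) (i l : Fin n) :
    pdC i (fun x => f x * g (x l)) = fun x =>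
      f x * ((Pi.single i (1 : ℝ) : Vec n) l * deriv g (x l)) + pdC i f x * g (x l) := by
  funext x
  have h1 : HasFDerivAt (fun x : Vec n => g (x l))
      ((ContinuousLinearMap.toSpanSingleton ℝ (deriv g (x l))).comp
        (ContinuousLinearMap.proj (R := ℝ) (φ := fun _ : Fin n => ℝ) l)) x :=
    ((hg.differentiable (by simp)) (x l)).hasDerivAt.hasFDerivAt.comp x
      (ContinuousLinearMap.proj (R := ℝ) (φ := fun _ : Fin n => ℝ) l).hasFDerivAt
  have h := (contDiff_top_differentiable hf x).hasFDerivAt.mul h1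
  have h' : fderiv ℝ (fun x => f x * g (x l)) x = _ := h.fderiv
  simp [pdC, h']
  ring

theorem foldr_pdC_mul_comp_coord {n : ℕ} {f : Vec n → ℂ} (hf : ContDiff ℝ (⊤ : ℕ∞) f)
    {g : ℝ → ℂ} (hg : ContDiff ℝ (⊤ : ℕ∞) g) (A : Fin n → ℕ) (l : Fin n) (L : List (Fin n))
    (hL : l ∉ L) :
    L.foldr (fun i g => (pdC i)^[A i] g) (fun x => f x * g (x l)) =
      fun x => L.foldr (fun i g => (pdC i)^[A i] g) f x * g (x l) := by
  induction L with
  | nil => rfl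
  | cons i L ih =>
    obtain ⟨hi, hL⟩ := not_or.mp (mt List.mem_cons.mpr hL)
    simp only [List.foldr_cons, ih hL]
    induction A i with
    | zero => rfl
    | succ k ihk =>
      simp only [Function.iterate_succ_apply', ihk]
      rw [pdC_mul_comp_coord (contDiff_iterate_pdC (contDiff_foldr_pdC hf A L) i k) hg]
      simp [hi]

theorem contDiff_iteratedDeriv {g : ℝ → ℂ} (hg : ContDiff ℝ (⊤ : ℕ∞) g) (k : ℕ) :
    ContDiff ℝ (⊤ : ℕ∞) (iteratedDeriv k g) := by
  rw [iteratedDeriv_eq_iterate]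
  exact ContDiff.iterate_deriv k hg

theorem iterate_pdC_mul_comp_coord {n : ℕ} {f : Vec n → ℂ} (hf : ContDiff ℝ (⊤ : ℕ∞) f)
    {g : ℝ → ℂ} (hg : ContDiff ℝ (⊤ : ℕ∞) g) (i : Fin n) (k : ℕ) :
    (pdC i)^[k] (fun x => f x * g (x i)) = fun x => ∑ s ∈ Finset.HasAntidiagonal.antidiagonal k,
      (k.choose s.1 : ℂ) * ((pdC i)^[s.1] f x * iteratedDeriv s.2 g (x i)) := by
  induction k with
  | zero => simp
  | succ k ih =>
    have hs : ∀ s : ℕ × ℕ, ContDiff ℝ (⊤ : ℕ∞)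
        (fun x : Vec n => (pdC i)^[s.1] f x * iteratedDeriv s.2 g (x i)) := fun s =>
      (contDiff_iterate_pdC hf i s.1).mul (contDiff_comp_coord (contDiff_iteratedDeriv hg s.2) i)
    rw [Function.iterate_succ_apply', ih, pdC_sum _ _ hs]
    funext x
    rw [Finset.sum_antidiagonal_choose_succ_mul
      (fun a b => (pdC i)^[a] f x * iteratedDeriv b g (x i)) k, ← Finset.sum_add_distrib]
    refine Finset.sum_congr rfl fun s hsk => ?_
    rw [pdC_mul_comp_coord (contDiff_iterate_pdC hf i s.1) (contDiff_iteratedDeriv hg s.2),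
      iteratedDeriv_succ, Function.iterate_succ_apply',
      ← Nat.choose_symm_of_eq_add (Finset.HasAntidiagonal.mem_antidiagonal.mp hsk).symm]
    simp
    ring

theorem mpd_mul_comp_radial {n : ℕ} [NeZero n] {f : Vec n → ℂ} (hf : ContDiff ℝ (⊤ : ℕ∞) f)
    {g : ℝ → ℂ} (hg : ContDiff ℝ (⊤ : ℕ∞) g) (A : Fin n → ℕ) :
    mpd A (fun x => f x * g (x 0)) = fun x => ∑ s ∈ Finset.HasAntidiagonal.antidiagonal (A 0),
      ((A 0).choose s.1 : ℂ) *
        (mpd (Function.update A 0 s.1) f x * iteratedDeriv s.2 g (x 0)) := by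
  obtain ⟨k, rfl⟩ := Nat.exists_eq_succ_of_ne_zero (NeZero.ne n)
  have h0 : (0 : Fin (k + 1)) ∉ (List.finRange k).map Fin.succ := by
    simp [Fin.succ_ne_zero]
  have hupd : ∀ (a : ℕ) (L : List (Fin (k + 1))), (0 : Fin (k + 1)) ∉ L →
      L.foldr (fun i g => (pdC i)^[Function.update A 0 a i] g) f =
        L.foldr (fun i g => (pdC i)^[A i] g) f := by
    intro a L hL
    induction L with
    | nil => rfl
    | cons i L ih =>
      obtain ⟨hi, hL⟩ := not_or.mp (mt List.mem_cons.mpr hL)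
      simp only [List.foldr_cons, ih hL, Function.update_of_ne (Ne.symm hi)]
  unfold mpd
  simp only [List.finRange_succ, List.foldr_cons]
  rw [foldr_pdC_mul_comp_coord hf hg A 0 _ h0,
    iterate_pdC_mul_comp_coord (contDiff_foldr_pdC hf A _) hg 0 (A 0)]
  funext x
  refine Finset.sum_congr rfl fun s _ => ?_
  rw [hupd s.1 _ h0, Function.update_self]

/-! ### Derivatives of bisymbols -/

/-- Joint smoothness of a function of `(q, p, q')`. -/
def SmoothBisym {n : ℕ} (a : Vec n → Vec n → Vec n → ℂ) : Prop :=
  ContDiff ℝ (⊤ : ℕ∞) (fun x : Vec n × Vec n × Vec n => a x.1 x.2.1 x.2.2)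

namespace SmoothBisym

variable {n : ℕ} {a : Vec n → Vec n → Vec n → ℂ}

theorem comp {E : Type*} [NormedAddCommGroup E] [NormedSpace ℝ E] (ha : SmoothBisym a)
    {u v w : E → Vec n} (hu : ContDiff ℝ (⊤ : ℕ∞) u) (hv : ContDiff ℝ (⊤ : ℕ∞) v)
    (hw : ContDiff ℝ (⊤ : ℕ∞) w) : ContDiff ℝ (⊤ : ℕ∞) (fun x => a (u x) (v x) (w x)) :=
  ContDiff.comp ha (hu.prodMk (hv.prodMk hw))

theorem slot1 (ha : SmoothBisym a) (p q' : Vec n) : ContDiff ℝ (⊤ : ℕ∞) (fun x => a x p q') :=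
  ha.comp contDiff_id contDiff_const contDiff_const

theorem slot2 (ha : SmoothBisym a) (q q' : Vec n) : ContDiff ℝ (⊤ : ℕ∞) (fun x => a q x q') :=
  ha.comp contDiff_const contDiff_id contDiff_const

theorem slot3 (ha : SmoothBisym a) (q p : Vec n) : ContDiff ℝ (⊤ : ℕ∞) (fun x => a q p x) :=
  ha.comp contDiff_const contDiff_const contDiff_id

theorem d2B (ha : SmoothBisym a) (B : Fin n → ℕ) : SmoothBisym (d2B B a) := by
  have h := contDiff_mpd_param (P := Vec n × Vec n) (F := fun z x => a z.1 x z.2)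
    (ha.comp (contDiff_fst.comp contDiff_fst) contDiff_snd (contDiff_snd.comp contDiff_fst)) B
  exact h.comp (g := fun z : (Vec n × Vec n) × Vec n => mpd B (fun x => a z.1.1 x z.1.2) z.2)
    (f := fun x : Vec n × Vec n × Vec n => ((x.1, x.2.2), x.2.1)) (by fun_prop)

theorem d3B (ha : SmoothBisym a) (A : Fin n → ℕ) : SmoothBisym (d3B A a) := by
  have h := contDiff_mpd_param (P := Vec n × Vec n) (F := fun z x => a z.1 z.2 x)
    (ha.comp (contDiff_fst.comp contDiff_fst) (contDiff_snd.comp contDiff_fst) contDiff_snd) A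
  exact h.comp (g := fun z : (Vec n × Vec n) × Vec n => mpd A (fun x => a z.1.1 z.1.2 x) z.2)
    (f := fun x : Vec n × Vec n × Vec n => ((x.1, x.2.1), x.2.2)) (by fun_prop)

end SmoothBisym

/-- The diagonal weights `(1, w, …, w)`. -/
def radialWeight {n : ℕ} [NeZero n] (w : ℝ) : Vec n := fun i => if i = 0 then 1 else w

theorem scaleQ_eq_mul {n : ℕ} [NeZero n] (μ : ℝ) (q : Vec n) :
    scaleQ μ q = radialWeight μ⁻¹ * q := by
  ext i
  by_cases hi : i = 0 <;> simp [scaleQ, radialWeight, hi]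

theorem scaleP_eq_mul {n : ℕ} [NeZero n] (μ : ℝ) (p : Vec n) :
    scaleP μ p = radialWeight μ * p := by
  ext i
  by_cases hi : i = 0 <;> simp [scaleP, radialWeight, hi]

theorem contDiff_scaleQ {n : ℕ} [NeZero n] (μ : ℝ) :
    ContDiff ℝ (⊤ : ℕ∞) (scaleQ μ : Vec n → Vec n) := by
  simp_rw [funext (scaleQ_eq_mul μ)]
  exact contDiff_const.mul contDiff_id

theorem contDiff_scaleP {n : ℕ} [NeZero n] (μ : ℝ) :
    ContDiff ℝ (⊤ : ℕ∞) (scaleP μ : Vec n → Vec n) := by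
  simp_rw [funext (scaleP_eq_mul μ)]
  exact contDiff_const.mul contDiff_id

theorem prod_radialWeight_pow {n : ℕ} [NeZero n] (w : ℝ) (A : Fin n → ℕ) :
    ∏ i, (radialWeight w i : ℂ) ^ A i = (w : ℂ) ^ angLen A := by
  rw [angLen, ← Finset.prod_pow_eq_pow_sum]
  refine Finset.prod_congr rfl fun i _ => ?_
  by_cases hi : i = 0 <;> simp [radialWeight, hi]

theorem angLen_update_zero {n : ℕ} [NeZero n] (A : Fin n → ℕ) (l : ℕ) :
    angLen (Function.update A 0 l) = angLen A := by
  refine Finset.sum_congr rfl fun i _ => ?_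
  by_cases hi : i = 0 <;> simp [hi]

theorem fullLen_update_zero_le {n : ℕ} [NeZero n] {A : Fin n → ℕ} {l : ℕ} (hl : l ≤ A 0) :
    fullLen (Function.update A 0 l) ≤ fullLen A := by
  refine Finset.sum_le_sum fun i _ => ?_
  by_cases hi : i = 0
  · subst hi; simpa using hl
  · simp [hi]

theorem mpd_comp_scaleP {n : ℕ} [NeZero n] {f : Vec n → ℂ} (hf : ContDiff ℝ (⊤ : ℕ∞) f)
    (μ : ℝ) (B : Fin n → ℕ) :
    mpd B (fun x => f (scaleP μ x)) = fun x => (μ : ℂ) ^ angLen B * mpd B f (scaleP μ x) := by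
  simp_rw [scaleP_eq_mul, mpd_comp_mul hf, prod_radialWeight_pow]

theorem mpd_comp_scaleQ_mul {n : ℕ} [NeZero n] {f : Vec n → ℂ} (hf : ContDiff ℝ (⊤ : ℕ∞) f)
    {g : ℝ → ℂ} (hg : ContDiff ℝ (⊤ : ℕ∞) g) (μ : ℝ) (A : Fin n → ℕ) :
    mpd A (fun x => f (scaleQ μ x) * g (x 0)) = fun x =>
      ∑ s ∈ Finset.HasAntidiagonal.antidiagonal (A 0),
        ((A 0).choose s.1 * ((μ⁻¹ : ℝ) : ℂ) ^ angLen A * iteratedDeriv s.2 g (x 0)) *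
          mpd (Function.update A 0 s.1) f (scaleQ μ x) := by
  have hf' : ContDiff ℝ (⊤ : ℕ∞) (fun x => f (scaleQ μ x)) := hf.comp (contDiff_scaleQ μ)
  rw [mpd_mul_comp_radial hf' hg]
  funext x
  refine Finset.sum_congr rfl fun s _ => ?_
  simp_rw [scaleQ_eq_mul, mpd_comp_mul hf, prod_radialWeight_pow, angLen_update_zero]
  ring

theorem derivs_scaled_mul {n : ℕ} [NeZero n] {a : Vec n → Vec n → Vec n → ℂ}
    (ha : SmoothBisym a) {g h : ℝ → ℂ} (hg : ContDiff ℝ (⊤ : ℕ∞) g)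
    (hh : ContDiff ℝ (⊤ : ℕ∞) h) (μ : ℝ) (A B A' : Fin n → ℕ) (q p q' : Vec n) :
    d1B A (d2B B (d3B A' fun q p q' =>
        a (scaleQ μ q) (scaleP μ p) (scaleQ μ q') * g (q 0) * h (q' 0))) q p q' =
      ∑ s' ∈ Finset.HasAntidiagonal.antidiagonal (A' 0),
        ((A' 0).choose s'.1 * ((μ⁻¹ : ℝ) : ℂ) ^ angLen A' * iteratedDeriv s'.2 h (q' 0) *
          (μ : ℂ) ^ angLen B) *
        ∑ s ∈ Finset.HasAntidiagonal.antidiagonal (A 0),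
          ((A 0).choose s.1 * ((μ⁻¹ : ℝ) : ℂ) ^ angLen A * iteratedDeriv s.2 g (q 0)) *
            d1B (Function.update A 0 s.1) (d2B B (d3B (Function.update A' 0 s'.1) a))
              (scaleQ μ q) (scaleP μ p) (scaleQ μ q') := by
  have h3 : d3B A' (fun q p q' =>
      a (scaleQ μ q) (scaleP μ p) (scaleQ μ q') * g (q 0) * h (q' 0)) = fun q p q' =>
      ∑ s' ∈ Finset.HasAntidiagonal.antidiagonal (A' 0),
        ((A' 0).choose s'.1 * ((μ⁻¹ : ℝ) : ℂ) ^ angLen A' * iteratedDeriv s'.2 h (q' 0) *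
          g (q 0)) *
          d3B (Function.update A' 0 s'.1) a (scaleQ μ q) (scaleP μ p) (scaleQ μ q') := by
    funext q p q'
    have hs := ha.slot3 (scaleQ μ q) (scaleP μ p)
    have hm : ContDiff ℝ (⊤ : ℕ∞) fun x : Vec n =>
        a (scaleQ μ q) (scaleP μ p) (scaleQ μ x) * h (x 0) :=
      (hs.comp (contDiff_scaleQ μ)).mul (contDiff_comp_coord hh 0)
    have he : (fun x : Vec n => a (scaleQ μ q) (scaleP μ p) (scaleQ μ x) * g (q 0) * h (x 0)) =
        fun x => g (q 0) * (a (scaleQ μ q) (scaleP μ p) (scaleQ μ x) * h (x 0)) := by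
      funext x; ring
    simp only [d3B]
    rw [he, mpd_const_mul _ hm, mpd_comp_scaleQ_mul hs hh]
    simp only [Finset.mul_sum]
    exact Finset.sum_congr rfl fun s _ => by ring
  have h2 : d2B B (d3B A' fun q p q' =>
      a (scaleQ μ q) (scaleP μ p) (scaleQ μ q') * g (q 0) * h (q' 0)) = fun q p q' =>
      ∑ s' ∈ Finset.HasAntidiagonal.antidiagonal (A' 0),
        ((A' 0).choose s'.1 * ((μ⁻¹ : ℝ) : ℂ) ^ angLen A' * iteratedDeriv s'.2 h (q' 0) *
          (μ : ℂ) ^ angLen B) *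
          (d2B B (d3B (Function.update A' 0 s'.1) a) (scaleQ μ q) (scaleP μ p) (scaleQ μ q') *
            g (q 0)) := by
    funext q p q'
    have hs := fun s' : ℕ × ℕ =>
      (ha.d3B (Function.update A' 0 s'.1)).slot2 (scaleQ μ q) (scaleQ μ q')
    have hc : ∀ s' : ℕ × ℕ, ContDiff ℝ (⊤ : ℕ∞) fun x =>
        d3B (Function.update A' 0 s'.1) a (scaleQ μ q) (scaleP μ x) (scaleQ μ q') :=
      fun s' => (hs s').comp (contDiff_scaleP μ)
    rw [h3]
    simp only [d2B]
    rw [mpd_sum _ _ hc]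
    refine Finset.sum_congr rfl fun s' _ => ?_
    rw [mpd_comp_scaleP (hs s') μ B]
    ring
  have hs := fun s' : ℕ × ℕ =>
    ((ha.d3B (Function.update A' 0 s'.1)).d2B B).slot1 (scaleP μ p) (scaleQ μ q')
  have hc : ∀ s' : ℕ × ℕ, ContDiff ℝ (⊤ : ℕ∞) fun x : Vec n =>
      d2B B (d3B (Function.update A' 0 s'.1) a) (scaleQ μ x) (scaleP μ p) (scaleQ μ q') *
        g (x 0) :=
    fun s' => ((hs s').comp (contDiff_scaleQ μ)).mul (contDiff_comp_coord hg 0)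
  rw [h2]
  simp only [d1B]
  rw [mpd_sum _ _ hc]
  refine Finset.sum_congr rfl fun s' _ => ?_
  rw [mpd_comp_scaleQ_mul (hs s') hg μ A]

/-! ### The localizing cutoff -/

theorem iteratedDeriv_cutoff_bounded {ψ : ℝ → ℝ} (hψ : ContDiff ℝ (⊤ : ℕ∞) ψ)
    (hψsupp : tsupport ψ ⊆ Set.Ioo (-1 : ℝ) 1) (l : ℕ) :
    ∃ K : ℝ, 0 ≤ K ∧ ∀ r s : ℝ, ‖iteratedDeriv l (fun x => (ψ (x - s) : ℂ)) r‖ ≤ K ∧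
      (1 < |r - s| → iteratedDeriv l (fun x => (ψ (x - s) : ℂ)) r = 0) := by
  have hΨ : ContDiff ℝ (⊤ : ℕ∞) (fun x => (ψ x : ℂ)) :=
    Complex.ofRealCLM.contDiff.comp hψ
  have hts : tsupport (fun x => (ψ x : ℂ)) ⊆ tsupport ψ :=
    tsupport_comp_subset (g := fun x : ℝ => (x : ℂ)) Complex.ofReal_zero ψ
  have hsub : tsupport (iteratedDeriv l (fun x => (ψ x : ℂ))) ⊆ Set.Ioo (-1 : ℝ) 1 := by
    refine subset_trans ?_ (hts.trans hψsupp)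
    induction l with
    | zero => simp
    | succ l ih => rw [iteratedDeriv_succ]; exact tsupport_deriv_subset.trans ih
  have hc : HasCompactSupport (iteratedDeriv l (fun x => (ψ x : ℂ))) :=
    (isCompact_Icc (a := (-1 : ℝ)) (b := 1)).of_isClosed_subset (isClosed_tsupport _)
      (hsub.trans Set.Ioo_subset_Icc_self)
  obtain ⟨K, hK⟩ := (contDiff_iteratedDeriv hΨ l).continuous.bounded_above_of_compact_support hc
  refine ⟨K, (norm_nonneg _).trans (hK 0), fun r s => ?_⟩
  rw [iteratedDeriv_comp_sub_const l (fun x => (ψ x : ℂ)) s]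
  refine ⟨hK _, fun hr => ?_⟩
  by_contra hne
  have := hsub (subset_tsupport _ hne)
  exact absurd (abs_lt.mpr this) (not_lt.mpr hr.le)

/-! ### The weighted bracket -/

theorem jbr_pos {n : ℕ} [NeZero n] (μ : ℝ) (p : Vec n) : 0 < jbr μ p :=
  Real.sqrt_pos.mpr (by positivity)

theorem jbr_scaleP {n : ℕ} [NeZero n] {μ : ℝ} (hμ : μ ≠ 0) (p : Vec n) :
    jbr μ (scaleP μ p) = jbr 1 p := by
  unfold jbr scaleP
  congr 2
  refine Finset.sum_congr rfl fun i _ => ?_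
  by_cases hi : i = 0 <;> simp [hi, hμ]

theorem jbr_rpow_mul_le_iff {n : ℕ} [NeZero n] (μ : ℝ) (p : Vec n) (m s x C : ℝ) :
    jbr μ p ^ (-m + s) * x ≤ C ↔ x ≤ C * jbr μ p ^ (m - s) := by
  have h : jbr μ p ^ (-m + s) = (jbr μ p ^ (m - s))⁻¹ := by
    rw [← Real.rpow_neg (jbr_pos μ p).le]; congr 1; ring
  rw [h, inv_mul_le_iff₀ (Real.rpow_pos_of_pos (jbr_pos μ p) _), mul_comm]

/-! ### Estimates -/

/-- The quantity whose supremum enters the seminorm `|a|_{λ : M, m, σ, t}`, for a fixed value `μ`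
of the weight. -/
noncomputable def weightedDeriv {n : ℕ} [NeZero n] (μ m σ : ℝ) (A B A' : Fin n → ℕ)
    (a : Vec n → Vec n → Vec n → ℂ) (q p q' : Vec n) : ℝ :=
  jbr μ p ^ (-m + σ * (fullLen B : ℝ)) *
    (μ ^ ((angLen B : ℤ) - (angLen A : ℤ) - (angLen A' : ℤ)) * ‖d1B A (d2B B (d3B A' a)) q p q'‖)

theorem weightedDeriv_nonneg {n : ℕ} [NeZero n] {μ : ℝ} (hμ : 0 ≤ μ) (m σ : ℝ)
    (A B A' : Fin n → ℕ) (a : Vec n → Vec n → Vec n → ℂ) (q p q' : Vec n) :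
    0 ≤ weightedDeriv μ m σ A B A' a q p q' :=
  mul_nonneg (Real.rpow_nonneg (jbr_pos μ p).le _)
    (mul_nonneg (zpow_nonneg hμ _) (norm_nonneg _))

theorem smoothBisym_scaled {n : ℕ} [NeZero n] {ψ : ℝ → ℝ} (hψ : ContDiff ℝ (⊤ : ℕ∞) ψ)
    {a : Vec n → Vec n → Vec n → ℂ} (ha : SmoothBisym a) (lam : ℝ → ℝ) (t : ℝ) (j k : ℤ) :
    SmoothBisym (scaledBisym lam ψ t j k a) := by
  have hcut : ∀ l : ℤ, ContDiff ℝ (⊤ : ℕ∞) fun x : Vec n => (ψ (x 0 - l) : ℂ) := fun l =>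
    Complex.ofRealCLM.contDiff.comp (hψ.comp ((contDiff_apply ℝ ℝ 0).sub contDiff_const))
  exact ((ha.comp ((contDiff_scaleQ _).comp contDiff_fst)
    ((contDiff_scaleP _).comp (contDiff_fst.comp contDiff_snd))
    ((contDiff_scaleQ _).comp (contDiff_snd.comp contDiff_snd))).mul
      ((hcut j).comp contDiff_fst)).mul ((hcut k).comp (contDiff_snd.comp contDiff_snd))

/-- The constant in the estimate of a scaled and localized bisymbol, where `K` bounds the
derivatives of the cutoff function. -/
def leibnizConst {n : ℕ} [NeZero n] (K : ℕ → ℝ) (A A' : Fin n → ℕ) : ℝ :=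
  ∑ s' ∈ Finset.HasAntidiagonal.antidiagonal (A' 0),
  ∑ s ∈ Finset.HasAntidiagonal.antidiagonal (A 0),
    (A' 0).choose s'.1 * (A 0).choose s.1 * (K s.2 * K s'.2)

theorem leibnizConst_nonneg {n : ℕ} [NeZero n] {K : ℕ → ℝ} (hK : ∀ l, 0 ≤ K l)
    (A A' : Fin n → ℕ) : 0 ≤ leibnizConst K A A' :=
  Finset.sum_nonneg fun s' _ => Finset.sum_nonneg fun s _ =>
    mul_nonneg (by positivity) (mul_nonneg (hK s.2) (hK s'.2))

theorem weightedDeriv_scaled_le {n : ℕ} [NeZero n] {lam : ℝ → ℝ} (hlam : ∀ r, 0 < lam r)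
    {ψ : ℝ → ℝ} (hψ : ContDiff ℝ (⊤ : ℕ∞) ψ) {K : ℕ → ℝ}
    (hK : ∀ l, 0 ≤ K l ∧ ∀ r s : ℝ, ‖iteratedDeriv l (fun x => (ψ (x - s) : ℂ)) r‖ ≤ K l ∧
      (1 < |r - s| → iteratedDeriv l (fun x => (ψ (x - s) : ℂ)) r = 0))
    {a : Vec n → Vec n → Vec n → ℂ} (ha : SmoothBisym a) (m σ t : ℝ) (j k : ℤ)
    (A B A' : Fin n → ℕ) {N : ℝ} (hN0 : 0 ≤ N)
    (hN : ∀ l ≤ A 0, ∀ l' ≤ A' 0, ∀ q p q' : Vec n, |q 0 - (j : ℝ)| ≤ 1 → |q' 0 - (k : ℝ)| ≤ 1 →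
      weightedDeriv (lamT lam t j k) m σ (Function.update A 0 l) B (Function.update A' 0 l') a
        q p q' ≤ N) (q p q' : Vec n) :
    weightedDeriv 1 m σ A B A' (scaledBisym lam ψ t j k a) q p q' ≤ leibnizConst K A A' * N := by
  have hcut : ∀ l : ℤ, ContDiff ℝ (⊤ : ℕ∞) fun x : ℝ => (ψ (x - l) : ℂ) := fun l =>
    Complex.ofRealCLM.contDiff.comp (hψ.comp (contDiff_id.sub contDiff_const))
  have hμ : 0 < lamT lam t j k := hlam _
  set μ := lamT lam t j k with hμdef
  have hJ : 0 ≤ jbr 1 p ^ (-m + σ * (fullLen B : ℝ)) := Real.rpow_nonneg (jbr_pos 1 p).le _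
  have hpow : ((μ⁻¹) ^ angLen A' * μ ^ angLen B * (μ⁻¹) ^ angLen A) =
      μ ^ ((angLen B : ℤ) - (angLen A : ℤ) - (angLen A' : ℤ)) := by
    rw [zpow_sub₀ hμ.ne', zpow_sub₀ hμ.ne', zpow_natCast, zpow_natCast, zpow_natCast,
      inv_pow, inv_pow]
    field_simp
  have hd := derivs_scaled_mul ha (hcut j) (hcut k) μ A B A' q p q'
  have hterm : ∀ s ∈ Finset.HasAntidiagonal.antidiagonal (A 0),
      ∀ s' ∈ Finset.HasAntidiagonal.antidiagonal (A' 0),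
      jbr 1 p ^ (-m + σ * (fullLen B : ℝ)) *
        (μ ^ ((angLen B : ℤ) - (angLen A : ℤ) - (angLen A' : ℤ)) *
          ‖d1B (Function.update A 0 s.1) (d2B B (d3B (Function.update A' 0 s'.1) a))
            (scaleQ μ q) (scaleP μ p) (scaleQ μ q')‖) *
        (‖iteratedDeriv s.2 (fun x => (ψ (x - j) : ℂ)) (q 0)‖ *
          ‖iteratedDeriv s'.2 (fun x => (ψ (x - k) : ℂ)) (q' 0)‖) ≤ N * (K s.2 * K s'.2) := by
    intro s hs s' hs'
    have hA := Finset.HasAntidiagonal.mem_antidiagonal.mp hs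
    have hA' := Finset.HasAntidiagonal.mem_antidiagonal.mp hs'
    have hKK := mul_nonneg (hK s.2).1 (hK s'.2).1
    by_cases hq : |q 0 - (j : ℝ)| ≤ 1
    · by_cases hq' : |q' 0 - (k : ℝ)| ≤ 1
      · have h := hN s.1 (by omega) s'.1 (by omega)
          (scaleQ μ q) (scaleP μ p) (scaleQ μ q') (by simpa [scaleQ] using hq)
          (by simpa [scaleQ] using hq')
        rw [weightedDeriv, jbr_scaleP hμ.ne', angLen_update_zero, angLen_update_zero] at h
        exact mul_le_mul h (mul_le_mul ((hK _).2 _ _).1 ((hK _).2 _ _).1 (norm_nonneg _)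
          (hK _).1) (by positivity) hN0
      · rw [((hK s'.2).2 _ _).2 (not_le.mp hq')]
        simpa using mul_nonneg hN0 hKK
    · rw [((hK s.2).2 _ _).2 (not_le.mp hq)]
      simpa using mul_nonneg hN0 hKK
  have hnorm : ‖d1B A (d2B B (d3B A' (scaledBisym lam ψ t j k a))) q p q'‖ ≤
      ∑ s' ∈ Finset.HasAntidiagonal.antidiagonal (A' 0),
        ∑ s ∈ Finset.HasAntidiagonal.antidiagonal (A 0),
          ((A' 0).choose s'.1 * (A 0).choose s.1 : ℝ) *
            (μ ^ ((angLen B : ℤ) - (angLen A : ℤ) - (angLen A' : ℤ)) *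
            ‖d1B (Function.update A 0 s.1) (d2B B (d3B (Function.update A' 0 s'.1) a))
              (scaleQ μ q) (scaleP μ p) (scaleQ μ q')‖ *
            (‖iteratedDeriv s.2 (fun x => (ψ (x - j) : ℂ)) (q 0)‖ *
              ‖iteratedDeriv s'.2 (fun x => (ψ (x - k) : ℂ)) (q' 0)‖)) := by
    have he : ‖d1B A (d2B B (d3B A' (scaledBisym lam ψ t j k a))) q p q'‖ = _ := congrArg norm hd
    rw [he]
    refine norm_sum_le_of_le _ fun s' _ => ?_
    rw [Finset.mul_sum]
    refine norm_sum_le_of_le _ fun s _ => le_of_eq ?_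
    rw [← hpow]
    simp only [norm_mul, norm_pow, Complex.norm_natCast, Complex.norm_real, Real.norm_eq_abs,
      abs_of_pos hμ, abs_of_pos (inv_pos.mpr hμ)]
    ring
  rw [weightedDeriv, one_zpow, one_mul]
  refine (mul_le_mul_of_nonneg_left hnorm hJ).trans ?_
  simp only [leibnizConst, Finset.mul_sum, Finset.sum_mul]
  refine Finset.sum_le_sum fun s' hs' => Finset.sum_le_sum fun s hs => ?_
  have h := mul_le_mul_of_nonneg_left (hterm s hs s' hs')
    (by positivity : (0 : ℝ) ≤ (A' 0).choose s'.1 * (A 0).choose s.1)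
  refine le_trans (le_of_eq ?_) (h.trans (le_of_eq ?_)) <;> ring

/-! ### Seminorms -/

theorem le_iSup₅_of_bounded {ι₁ ι₂ ι₃ ι₄ ι₅ : Type*} {F : ι₁ → ι₂ → ι₃ → ι₄ → ι₅ → ℝ} {C : ℝ}
    (hC : 0 ≤ C) (hF : ∀ x y z u v, F x y z u v ≤ C) (x : ι₁) (y : ι₂) (z : ι₃) (u : ι₄)
    (v : ι₅) : F x y z u v ≤ ⨆ x, ⨆ y, ⨆ z, ⨆ u, ⨆ v, F x y z u v := by
  have h5 : ∀ x y z u, ⨆ v, F x y z u v ≤ C := fun x y z u => Real.iSup_le (hF x y z u) hC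
  have h4 : ∀ x y z, ⨆ u, ⨆ v, F x y z u v ≤ C := fun x y z => Real.iSup_le (h5 x y z) hC
  have h3 : ∀ x y, ⨆ z, ⨆ u, ⨆ v, F x y z u v ≤ C := fun x y => Real.iSup_le (h4 x y) hC
  have h2 : ∀ x, ⨆ y, ⨆ z, ⨆ u, ⨆ v, F x y z u v ≤ C := fun x => Real.iSup_le (h3 x) hC
  have hb1 : BddAbove (Set.range fun x => ⨆ y, ⨆ z, ⨆ u, ⨆ v, F x y z u v) :=
    ⟨C, Set.forall_mem_range.mpr h2⟩
  have hb2 : BddAbove (Set.range fun y => ⨆ z, ⨆ u, ⨆ v, F x y z u v) :=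
    ⟨C, Set.forall_mem_range.mpr (h3 x)⟩
  have hb3 : BddAbove (Set.range fun z => ⨆ u, ⨆ v, F x y z u v) :=
    ⟨C, Set.forall_mem_range.mpr (h4 x y)⟩
  have hb4 : BddAbove (Set.range fun u => ⨆ v, F x y z u v) :=
    ⟨C, Set.forall_mem_range.mpr (h5 x y z)⟩
  have hb5 : BddAbove (Set.range fun v => F x y z u v) :=
    ⟨C, Set.forall_mem_range.mpr (hF x y z u)⟩
  exact (le_ciSup hb5 v).trans <| (le_ciSup hb4 u).trans <| (le_ciSup hb3 z).trans <|
    (le_ciSup hb2 y).trans <| le_ciSup hb1 x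

/-- The supremum of the weighted derivative of order `(A, B, A')`. -/
noncomputable def bisymSup {n : ℕ} [NeZero n] (lam : ℝ → ℝ) (m σ t : ℝ) (A B A' : Fin n → ℕ)
    (a : Vec n → Vec n → Vec n → ℂ) : ℝ :=
  ⨆ j : ℤ, ⨆ k : ℤ, ⨆ q : Vec n, ⨆ p : Vec n, ⨆ q' : Vec n,
    if |q 0 - (j : ℝ)| ≤ 1 ∧ |q' 0 - (k : ℝ)| ≤ 1 then
      weightedDeriv (lamT lam t j k) m σ A B A' a q p q'
    else 0

theorem bisymSeminorm_eq {n : ℕ} [NeZero n] (lam : ℝ → ℝ) (M : ℕ) (m σ t : ℝ)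
    (a : Vec n → Vec n → Vec n → ℂ) :
    bisymSeminorm lam M m σ t a =
      ∑ A : Fin n → Fin (M + 1), ∑ B : Fin n → Fin (M + 1), ∑ A' : Fin n → Fin (M + 1),
        if fullLen (fun i => (A i : ℕ)) + fullLen (fun i => (B i : ℕ))
            + fullLen (fun i => (A' i : ℕ)) ≤ M then
          bisymSup lam m σ t (fun i => (A i : ℕ)) (fun i => (B i : ℕ)) (fun i => (A' i : ℕ)) a
        else 0 :=
  rfl

theorem bisymSup_nonneg {n : ℕ} [NeZero n] {lam : ℝ → ℝ} (hlam : ∀ r, 0 < lam r) (m σ t : ℝ)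
    (A B A' : Fin n → ℕ) (a : Vec n → Vec n → Vec n → ℂ) : 0 ≤ bisymSup lam m σ t A B A' a := by
  refine Real.iSup_nonneg fun j => Real.iSup_nonneg fun k => Real.iSup_nonneg fun q =>
    Real.iSup_nonneg fun p => Real.iSup_nonneg fun q' => ?_
  split_ifs
  · exact weightedDeriv_nonneg (hlam _).le ..
  · exact le_rfl

theorem bisymSup_le {n : ℕ} [NeZero n] {lam : ℝ → ℝ} {m σ t : ℝ} {A B A' : Fin n → ℕ}
    {a : Vec n → Vec n → Vec n → ℂ} {C : ℝ} (hC : 0 ≤ C)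
    (h : ∀ (j k : ℤ) (q p q' : Vec n), |q 0 - (j : ℝ)| ≤ 1 → |q' 0 - (k : ℝ)| ≤ 1 →
      weightedDeriv (lamT lam t j k) m σ A B A' a q p q' ≤ C) :
    bisymSup lam m σ t A B A' a ≤ C := by
  refine Real.iSup_le (fun j => Real.iSup_le (fun k => Real.iSup_le (fun q =>
    Real.iSup_le (fun p => Real.iSup_le (fun q' => ?_) hC) hC) hC) hC) hC
  split_ifs with hq
  · exact h j k q p q' hq.1 hq.2
  · exact hC

theorem IsBisymbol.weightedDeriv_le {n : ℕ} [NeZero n] {lam : ℝ → ℝ} {m σ t : ℝ}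
    {a : Vec n → Vec n → Vec n → ℂ} (ha : IsBisymbol lam m σ t a) (A B A' : Fin n → ℕ) :
    ∃ C > 0, ∀ (j k : ℤ) (q p q' : Vec n), |q 0 - (j : ℝ)| ≤ 1 → |q' 0 - (k : ℝ)| ≤ 1 →
      weightedDeriv (lamT lam t j k) m σ A B A' a q p q' ≤ C := by
  obtain ⟨C, hC, h⟩ := ha.2 A B A'
  exact ⟨C, hC, fun j k q p q' hq hq' =>
    (jbr_rpow_mul_le_iff ..).mpr (h j k q p q' hq hq')⟩

theorem IsBisymbol.weightedDeriv_le_bisymSup {n : ℕ} [NeZero n] {lam : ℝ → ℝ} {m σ t : ℝ}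
    {a : Vec n → Vec n → Vec n → ℂ} (ha : IsBisymbol lam m σ t a) (A B A' : Fin n → ℕ)
    (j k : ℤ) (q p q' : Vec n) (hq : |q 0 - (j : ℝ)| ≤ 1) (hq' : |q' 0 - (k : ℝ)| ≤ 1) :
    weightedDeriv (lamT lam t j k) m σ A B A' a q p q' ≤ bisymSup lam m σ t A B A' a := by
  obtain ⟨C, hC, h⟩ := ha.weightedDeriv_le A B A'
  have := le_iSup₅_of_bounded (F := fun (j k : ℤ) (q p q' : Vec n) =>
    if |q 0 - (j : ℝ)| ≤ 1 ∧ |q' 0 - (k : ℝ)| ≤ 1 then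
      weightedDeriv (lamT lam t j k) m σ A B A' a q p q' else 0) hC.le
    (fun j k q p q' => by
      split_ifs with hq
      · exact h j k q p q' hq.1 hq.2
      · exact hC.le) j k q p q'
  refine le_trans (le_of_eq ?_) this
  simp only [hq, hq', and_self, if_true]

theorem bisymSup_le_bisymSeminorm {n : ℕ} [NeZero n] {lam : ℝ → ℝ} (hlam : ∀ r, 0 < lam r)
    {M : ℕ} (m σ t : ℝ) {A B A' : Fin n → ℕ} (hM : fullLen A + fullLen B + fullLen A' ≤ M)
    (a : Vec n → Vec n → Vec n → ℂ) :
    bisymSup lam m σ t A B A' a ≤ bisymSeminorm lam M m σ t a := by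
  have hlift : ∀ D : Fin n → ℕ, fullLen D ≤ M →
      ∃ D' : Fin n → Fin (M + 1), (fun i => (D' i : ℕ)) = D := fun D hD =>
    ⟨fun i => ⟨D i, Nat.lt_succ_of_le
      ((Finset.single_le_sum (fun _ _ => Nat.zero_le _) (Finset.mem_univ i)).trans hD)⟩, rfl⟩
  obtain ⟨A, rfl⟩ := hlift A (by omega)
  obtain ⟨B, rfl⟩ := hlift B (by omega)
  obtain ⟨A', rfl⟩ := hlift A' (by omega)
  rw [bisymSeminorm_eq]
  have h0 : ∀ A B A' : Fin n → Fin (M + 1), 0 ≤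
      if fullLen (fun i => (A i : ℕ)) + fullLen (fun i => (B i : ℕ))
          + fullLen (fun i => (A' i : ℕ)) ≤ M then
        bisymSup lam m σ t (fun i => (A i : ℕ)) (fun i => (B i : ℕ)) (fun i => (A' i : ℕ)) a
      else 0 := by
    intro A B A'
    split_ifs
    · exact bisymSup_nonneg hlam ..
    · exact le_rfl
  refine le_trans ?_ (Finset.single_le_sum (fun A _ => Finset.sum_nonneg fun B _ =>
    Finset.sum_nonneg fun A' _ => h0 A B A') (Finset.mem_univ A))
  refine le_trans ?_ (Finset.single_le_sum (fun B _ =>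
    Finset.sum_nonneg fun A' _ => h0 A B A') (Finset.mem_univ B))
  refine le_trans ?_ (Finset.single_le_sum (fun A' _ => h0 A B A') (Finset.mem_univ A'))
  rw [if_pos hM]

theorem bisymSeminorm_nonneg {n : ℕ} [NeZero n] {lam : ℝ → ℝ} (hlam : ∀ r, 0 < lam r)
    (M : ℕ) (m σ t : ℝ) (a : Vec n → Vec n → Vec n → ℂ) : 0 ≤ bisymSeminorm lam M m σ t a :=
  (bisymSup_nonneg hlam m σ t 0 0 0 a).trans
    (bisymSup_le_bisymSeminorm hlam m σ t (by simp [fullLen]) a)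

/-- **Lemma 3.2.**  Let `λ` satisfy the admissibility condition.  If `a ∈ BS^m_σ(λ;t)`
then `a^t_{jk} ∈ BS^m_σ(1;t)` for all `j, k ∈ ℤ`.  Moreover for each `M ≥ 0` there is
`C_M > 0` with `|a^t_{jk}|_{1:M,m,σ,t} ≤ C_M |a|_{λ:M,m,σ,t}` for all `t ∈ [0,1]`,
all `a ∈ BS^m_σ(λ;t)` and all `j, k ∈ ℤ`. -/
theorem scaled_bisymbol
    (n : ℕ) [NeZero n] (lam : ℝ → ℝ) (hlam : Admissible lam)
    (ψ : ℝ → ℝ) (hψ : ContDiff ℝ (⊤ : ℕ∞) ψ) (hψsupp : tsupport ψ ⊆ Set.Ioo (-1 : ℝ) 1)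
    (hψpos : ∀ r, 0 ≤ ψ r) (hψsum : ∀ r : ℝ, ∑' j : ℤ, ψ (r - j) = 1)
    (m σ : ℝ) (hσ : σ ∈ Set.Icc (0 : ℝ) 1) :
    (∀ t ∈ Set.Icc (0 : ℝ) 1, ∀ a : Vec n → Vec n → Vec n → ℂ, IsBisymbol lam m σ t a →
      ∀ j k : ℤ, IsBisymbol (fun _ => 1) m σ t (scaledBisym lam ψ t j k a)) ∧
    (∀ M : ℕ, ∃ C > 0, ∀ t ∈ Set.Icc (0 : ℝ) 1,
      ∀ a : Vec n → Vec n → Vec n → ℂ, IsBisymbol lam m σ t a → ∀ j k : ℤ,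
        bisymSeminorm (fun _ => 1) M m σ t (scaledBisym lam ψ t j k a)
          ≤ C * bisymSeminorm lam M m σ t a) := by
  choose K hK using iteratedDeriv_cutoff_bounded hψ hψsupp
  obtain ⟨hpos, -⟩ := hlam
  refine ⟨fun t _ a ha j k => ⟨smoothBisym_scaled hψ ha.1 lam t j k, fun A B A' => ?_⟩,
    fun M => ?_⟩
  · set N : ℝ := ∑ l ∈ Finset.range (A 0 + 1), ∑ l' ∈ Finset.range (A' 0 + 1),
      bisymSup lam m σ t (Function.update A 0 l) B (Function.update A' 0 l') a with hNdef
    have h0 : ∀ l l' : ℕ,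
        0 ≤ bisymSup lam m σ t (Function.update A 0 l) B (Function.update A' 0 l') a :=
      fun l l' => bisymSup_nonneg hpos ..
    have hN0 : 0 ≤ N := Finset.sum_nonneg fun l _ => Finset.sum_nonneg fun l' _ => h0 l l'
    have hC := mul_nonneg (leibnizConst_nonneg (fun l => (hK l).1) A A') hN0
    refine ⟨leibnizConst K A A' * N + 1, by linarith, fun j' k' q p q' _ _ => ?_⟩
    have h := weightedDeriv_scaled_le hpos hψ hK ha.1 m σ t j k A B A' hN0
      (fun l hl l' hl' q p q' hq hq' =>
        (ha.weightedDeriv_le_bisymSup _ _ _ j k q p q' hq hq').trans <|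
          (Finset.single_le_sum (fun l' _ => h0 l l')
            (Finset.mem_range.mpr (Nat.lt_succ_of_le hl'))).trans <|
          Finset.single_le_sum (f := fun l => ∑ l' ∈ Finset.range (A' 0 + 1),
              bisymSup lam m σ t (Function.update A 0 l) B (Function.update A' 0 l') a)
            (fun l _ => Finset.sum_nonneg fun l' _ => h0 l l')
            (Finset.mem_range.mpr (Nat.lt_succ_of_le hl))) q p q'
    exact (jbr_rpow_mul_le_iff ..).mp (h.trans (by linarith))
  · have hL : ∀ A A' : Fin n → Fin (M + 1),
        0 ≤ leibnizConst K (fun i => (A i : ℕ)) (fun i => (A' i : ℕ)) := fun A A' =>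
      leibnizConst_nonneg (fun l => (hK l).1) _ _
    have hC : 0 ≤ ∑ A : Fin n → Fin (M + 1), ∑ _B : Fin n → Fin (M + 1),
        ∑ A' : Fin n → Fin (M + 1),
          leibnizConst K (fun i => (A i : ℕ)) (fun i => (A' i : ℕ)) :=
      Finset.sum_nonneg fun A _ => Finset.sum_nonneg fun B _ => Finset.sum_nonneg fun A' _ =>
        hL A A'
    refine ⟨_, add_pos_of_nonneg_of_pos hC one_pos, fun t _ a ha j k => ?_⟩
    have hS := bisymSeminorm_nonneg hpos M m σ t a
    rw [add_mul, one_mul]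
    refine le_add_of_le_of_nonneg ?_ hS
    rw [bisymSeminorm_eq]
    simp only [Finset.sum_mul]
    refine Finset.sum_le_sum fun A _ => Finset.sum_le_sum fun B _ =>
      Finset.sum_le_sum fun A' _ => ?_
    split_ifs with hM
    · refine bisymSup_le (mul_nonneg (hL A A') hS) fun _ _ q p q' _ _ => ?_
      refine weightedDeriv_scaled_le hpos hψ hK ha.1 m σ t j k _ _ _ hS
        (fun l hl l' hl' q p q' hq hq' =>
          (ha.weightedDeriv_le_bisymSup _ _ _ j k q p q' hq hq').trans
            (bisymSup_le_bisymSeminorm hpos m σ t ?_ a)) q p q'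
      have h1 := fullLen_update_zero_le (A := fun i => (A i : ℕ)) hl
      have h2 := fullLen_update_zero_le (A := fun i => (A' i : ℕ)) hl'
      omega
    · exact mul_nonneg (hL A A') hS
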